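/- Let p, b_0, b_1 ∈ ℂ with 0 < |p| < 1 and |p| < |b_0|, |b_1| < 1, and set ρ = max(|b_0|, |b_1|, |p|/|b_0|, |p|/|b_1|). Then for every z ∈ ℂ with ρ < |z| < 1/ρ, the family (c_k z^k)_{k ∈ ℤ, k ≠ 0}, where c_k = ( b_0^k + (p/b_0)^k − b_1^k − (p/b_1)^k ) / (1 − p^k), is summable with sum (p;p)_∞² · b_1 · θ(b_0 b_1;p) θ(b_0/b_1;p) · θ(z²;p) / ( z · θ(b_0 z;p) θ(b_0/z;p) θ(b_1 z;p) θ(b_1/z;p) ). -/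

import Mathlib

open scoped BigOperators Real

/-- The theta function `θ(x;p)`. -/
noncomputable def ellTheta (x p : ℂ) : ℂ :=
  ∏' k : ℕ, ((1 - p ^ k * x) * (1 - p ^ (k + 1) / x))

/-- `(p;p)_∞`. -/
noncomputable def qPoch (p : ℂ) : ℂ := ∏' k : ℕ, (1 - p ^ (k + 1))

open Filter Topology

/-- The Gaussian binomial coefficient. -/
noncomputable def gaussBinom (q : ℂ) : ℕ → ℕ → ℂ
  | _, 0 => 1
  | 0, _ + 1 => 0
  | n + 1, k + 1 => gaussBinom q n (k + 1) + q ^ (n - k) * gaussBinom q n k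

lemma gaussBinom_zero_right (q : ℂ) (n : ℕ) : gaussBinom q n 0 = 1 := by
  cases n <;> rfl

lemma gaussBinom_succ_succ (q : ℂ) (n k : ℕ) :
    gaussBinom q (n + 1) (k + 1) =
      gaussBinom q n (k + 1) + q ^ (n - k) * gaussBinom q n k := rfl

lemma gaussBinom_eq_zero_of_lt (q : ℂ) {n k : ℕ} (h : n < k) : gaussBinom q n k = 0 := by
  induction n generalizing k with
  | zero => obtain ⟨k, rfl⟩ := Nat.exists_eq_succ_of_ne_zero h.ne'; rfl
  | succ n ih =>
    obtain ⟨k, rfl⟩ := Nat.exists_eq_succ_of_ne_zero (Nat.ne_of_gt (Nat.zero_lt_of_lt h))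
    rw [Nat.succ_eq_add_one, gaussBinom_succ_succ, ih (by omega), ih (by omega)]
    simp

/-- The finite product `(q;q)_n`. -/
noncomputable def qPochFin (q : ℂ) (n : ℕ) : ℂ := ∏ k ∈ Finset.range n, (1 - q ^ (k + 1))

lemma qPochFin_succ (q : ℂ) (n : ℕ) :
    qPochFin q (n + 1) = qPochFin q n * (1 - q ^ (n + 1)) :=
  Finset.prod_range_succ _ _

lemma gaussBinom_self (q : ℂ) (n : ℕ) : gaussBinom q n n = 1 := by
  induction n with
  | zero => rfl
  | succ n ih =>
    rw [gaussBinom_succ_succ, gaussBinom_eq_zero_of_lt q (Nat.lt_succ_self n), ih]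
    simp

lemma gaussBinom_mul_qPochFin (q : ℂ) (k m : ℕ) :
    gaussBinom q (k + m) k * (qPochFin q k * qPochFin q m) = qPochFin q (k + m) := by
  suffices ∀ n k m : ℕ, k + m = n →
      gaussBinom q n k * (qPochFin q k * qPochFin q m) = qPochFin q n from this _ _ _ rfl
  intro n
  induction n with
  | zero =>
    intro k m h
    obtain ⟨rfl, rfl⟩ : k = 0 ∧ m = 0 := by omega
    simp [gaussBinom_zero_right, qPochFin]
  | succ n ih =>
    intro k m h
    rcases k with _ | k
    · obtain rfl : m = n + 1 := by omega
      simp [gaussBinom_zero_right, qPochFin]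
    rcases m with _ | m
    · obtain rfl : k = n := by omega
      simp [gaussBinom_self, qPochFin]
    have h1 := ih (k + 1) m (by omega)
    have h2 := ih k (m + 1) (by omega)
    have hn : n = k + m + 1 := by omega
    have hnk : n - k = m + 1 := by omega
    rw [qPochFin_succ] at h1 h2
    rw [gaussBinom_succ_succ, qPochFin_succ, qPochFin_succ, qPochFin_succ, hnk]
    have e : q ^ (n + 1) = q ^ (m + 1) * q ^ (k + 1) := by rw [← pow_add]; congr 1; omega
    rw [e]
    linear_combination (1 - q ^ (m + 1)) * h1 + q ^ (m + 1) * (1 - q ^ (k + 1)) * h2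

/-- The `q`-binomial theorem. -/
lemma prod_one_sub_pow_mul (q y : ℂ) (n : ℕ) :
    ∏ k ∈ Finset.range n, (1 - q ^ k * y) =
      ∑ i ∈ Finset.range (n + 1), gaussBinom q n i * ∏ l ∈ Finset.range i, (-(q ^ l * y)) := by
  induction n with
  | zero => simp [gaussBinom_zero_right]
  | succ n ih =>
    rw [Finset.prod_range_succ, ih, Finset.sum_range_succ' _ (n + 1)]
    have hsplit : ∀ i ∈ Finset.range (n + 1),
        gaussBinom q (n + 1) (i + 1) * ∏ l ∈ Finset.range (i + 1), (-(q ^ l * y)) =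
        gaussBinom q n (i + 1) * ∏ l ∈ Finset.range (i + 1), (-(q ^ l * y)) -
          (q ^ n * y) * (gaussBinom q n i * ∏ l ∈ Finset.range i, (-(q ^ l * y))) := by
      intro i hi
      have hi' : i ≤ n := by simpa [Nat.lt_succ_iff] using hi
      have e : q ^ n = q ^ (n - i) * q ^ i := by rw [← pow_add]; congr 1; omega
      rw [gaussBinom_succ_succ, Finset.prod_range_succ, e]
      ring
    rw [Finset.sum_congr rfl hsplit, Finset.sum_sub_distrib, ← Finset.mul_sum]
    have hshift := Finset.sum_range_succ'
      (fun i => gaussBinom q n i * ∏ l ∈ Finset.range i, (-(q ^ l * y))) (n + 1)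
    rw [Finset.sum_range_succ, gaussBinom_eq_zero_of_lt q (Nat.lt_succ_self n)] at hshift
    simp only [gaussBinom_zero_right] at hshift ⊢
    linear_combination hshift

/-- The general term of the theta series. -/
noncomputable def thetaTerm (p x : ℂ) (j : ℤ) : ℂ := (-1) ^ j * p ^ (j * (j - 1) / 2) * x ^ j

lemma two_mul_triangle (j : ℤ) : 2 * (j * (j - 1) / 2) = j * (j - 1) :=
  Int.mul_ediv_cancel' (even_iff_two_dvd.mp (Int.even_mul_pred_self j))

lemma thetaTerm_succ {p x : ℂ} (hp : p ≠ 0) (hx : x ≠ 0) (j : ℤ) :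
    thetaTerm p x (j + 1) = thetaTerm p x j * -(p ^ j * x) := by
  have e : (j + 1) * (j + 1 - 1) / 2 = j * (j - 1) / 2 + j := by
    have h1 := two_mul_triangle j
    have h2 := two_mul_triangle (j + 1)
    have h3 : (j + 1) * (j + 1 - 1) = j * (j - 1) + 2 * j := by ring
    omega
  rw [thetaTerm, thetaTerm, e, zpow_add₀ hp, zpow_add_one₀ hx, zpow_add_one₀ (by norm_num)]
  ring

lemma thetaTerm_zero (p x : ℂ) : thetaTerm p x 0 = 1 := by simp [thetaTerm]

lemma thetaTerm_ne_zero {p x : ℂ} (hp : p ≠ 0) (hx : x ≠ 0) (j : ℤ) : thetaTerm p x j ≠ 0 :=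
  mul_ne_zero (mul_ne_zero (zpow_ne_zero _ (by norm_num)) (zpow_ne_zero _ hp)) (zpow_ne_zero _ hx)

lemma thetaTerm_neg_add_nat {p x : ℂ} (hp : p ≠ 0) (hx : x ≠ 0) (m i : ℕ) :
    thetaTerm p x (-m + i) =
      thetaTerm p x (-m) * ∏ l ∈ Finset.range i, (-(p ^ l * (p ^ (-(m : ℤ)) * x))) := by
  induction i with
  | zero => simp
  | succ i ih =>
    rw [Finset.prod_range_succ, ← mul_assoc, ← ih, Nat.cast_succ, ← add_assoc,
      thetaTerm_succ hp hx, zpow_add₀ hp, zpow_natCast]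
    ring

lemma thetaTerm_neg_succ {p x : ℂ} (hp : p ≠ 0) (hx : x ≠ 0) (m : ℕ) :
    thetaTerm p x (-(m + 1 : ℕ)) = thetaTerm p x (-m) * -(p ^ (m + 1) / x) := by
  have h := thetaTerm_succ hp hx (-(m + 1 : ℕ))
  rw [show (-((m + 1 : ℕ) : ℤ) + 1) = -m by push_cast; ring, zpow_neg, zpow_natCast] at h
  rw [h]
  field_simp

lemma prod_theta_eq_thetaTerm_mul {p x : ℂ} (hp : p ≠ 0) (hx : x ≠ 0) (m : ℕ) :
    ∏ k ∈ Finset.range m, ((1 - p ^ k * x) * (1 - p ^ (k + 1) / x)) =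
      thetaTerm p x (-m) *
        ∏ k ∈ Finset.range (2 * m), (1 - p ^ k * (p ^ (-(m : ℤ)) * x)) := by
  induction m with
  | zero => simp [thetaTerm_zero]
  | succ m ih =>
    have e : ∀ k : ℕ, p ^ (k + 1) * (p ^ (-((m + 1 : ℕ) : ℤ)) * x) =
        p ^ k * (p ^ (-(m : ℤ)) * x) := by
      intro k
      simp only [zpow_neg, zpow_natCast]
      rw [pow_succ, pow_succ]
      field_simp
    rw [Finset.prod_range_succ, ih, thetaTerm_neg_succ hp hx,
      show 2 * (m + 1) = 2 * m + 1 + 1 by ring, Finset.prod_range_succ']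
    simp only [e]
    rw [Finset.prod_range_succ]
    generalize ∏ k ∈ Finset.range (2 * m), (1 - p ^ k * (p ^ (-(m : ℤ)) * x)) = P
    simp only [zpow_neg, zpow_natCast]
    field_simp
    ring

/-- The finite Jacobi triple product. -/
lemma prod_theta_eq_sum {p x : ℂ} (hp : p ≠ 0) (hx : x ≠ 0) (m : ℕ) :
    ∏ k ∈ Finset.range m, ((1 - p ^ k * x) * (1 - p ^ (k + 1) / x)) =
      ∑ i ∈ Finset.range (2 * m + 1), gaussBinom p (2 * m) i * thetaTerm p x (-m + i) := by
  rw [prod_theta_eq_thetaTerm_mul hp hx, prod_one_sub_pow_mul, Finset.mul_sum]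
  refine Finset.sum_congr rfl fun i _ => ?_
  rw [thetaTerm_neg_add_nat hp hx]
  ring

lemma summable_norm_thetaTerm {p x : ℂ} (hp : p ≠ 0) (hp1 : ‖p‖ < 1) (hx : x ≠ 0) :
    Summable fun j : ℤ => ‖thetaTerm p x j‖ := by
  have hpow : Tendsto (fun n : ℕ => ‖p‖ ^ n) atTop (𝓝 0) :=
    tendsto_pow_atTop_nhds_zero_of_lt_one (norm_nonneg p) hp1
  have hne : ∀ j : ℤ, ‖thetaTerm p x j‖ ≠ 0 := fun j =>
    norm_ne_zero_iff.2 (thetaTerm_ne_zero hp hx j)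
  refine Summable.of_nat_of_neg ?_ ?_
  · refine summable_of_ratio_test_tendsto_lt_one (l := 0) one_pos (.of_forall fun n => hne _) ?_
    have := hpow.mul_const ‖x‖
    rw [zero_mul] at this
    refine this.congr fun n => ?_
    have := hne n
    rw [norm_norm, norm_norm, Nat.cast_succ, thetaTerm_succ hp hx, norm_mul, norm_neg, norm_mul,
      zpow_natCast, norm_pow]
    field_simp
  · refine summable_of_ratio_test_tendsto_lt_one (l := 0) one_pos (.of_forall fun n => hne _) ?_
    have := ((tendsto_add_atTop_iff_nat 1).2 hpow).div_const ‖x‖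
    rw [zero_div] at this
    refine this.congr fun n => ?_
    have := hne (-n)
    rw [norm_norm, norm_norm, thetaTerm_neg_succ hp hx, norm_mul, norm_neg, norm_div, norm_pow]
    field_simp

/-- The infinite product `(x;p)_∞`. -/
noncomputable def qProd (p x : ℂ) : ℂ := ∏' k : ℕ, (1 - p ^ k * x)

lemma summable_norm_pow_mul {p : ℂ} (hp1 : ‖p‖ < 1) (x : ℂ) :
    Summable fun k : ℕ => ‖-(p ^ k * x)‖ := by
  simp only [norm_neg, norm_mul, norm_pow]
  exact (summable_geometric_of_lt_one (norm_nonneg p) hp1).mul_right _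

lemma multipliable_qProd {p : ℂ} (hp1 : ‖p‖ < 1) (x : ℂ) :
    Multipliable fun k : ℕ => (1 - p ^ k * x) := by
  simpa [sub_eq_add_neg] using multipliable_one_add_of_summable (summable_norm_pow_mul hp1 x)

lemma qPoch_eq_qProd (p : ℂ) : qPoch p = qProd p p := by
  simp only [qPoch, qProd, pow_succ]

lemma ellTheta_eq_qProd_mul {p : ℂ} (hp1 : ‖p‖ < 1) (x : ℂ) :
    ellTheta x p = qProd p x * qProd p (p / x) := by
  rw [qProd, qProd, ← (multipliable_qProd hp1 x).tprod_mul (multipliable_qProd hp1 (p / x))]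
  simp only [ellTheta, pow_succ, mul_div_assoc]

lemma qProd_eq_one_sub_mul {p : ℂ} (hp1 : ‖p‖ < 1) (x : ℂ) :
    qProd p x = (1 - x) * qProd p (p * x) := by
  have e : ∀ k : ℕ, 1 - p ^ (k + 1) * x = 1 - p ^ k * (p * x) := fun k => by ring
  rw [qProd, qProd, tprod_eq_zero_mul' (f := fun k : ℕ => 1 - p ^ k * x)]
  · simp only [e, pow_zero, one_mul]
  · simpa only [e] using multipliable_qProd hp1 (p * x)

lemma one_sub_pow_mul_ne_zero {p x : ℂ} (hp1 : ‖p‖ < 1) (hx : ‖x‖ < 1) (k : ℕ) :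
    1 - p ^ k * x ≠ 0 := by
  intro h
  have h1 : ‖p ^ k * x‖ = 1 := by rw [← sub_eq_zero.1 h, norm_one]
  rw [norm_mul, norm_pow] at h1
  have := mul_le_of_le_one_left (norm_nonneg x) (pow_le_one₀ (norm_nonneg p) hp1.le (n := k))
  linarith

lemma qProd_ne_zero {p x : ℂ} (hp1 : ‖p‖ < 1) (hx : ‖x‖ < 1) : qProd p x ≠ 0 := by
  have := tprod_one_add_ne_zero_of_summable (f := fun k : ℕ => -(p ^ k * x))
    (fun k => by simpa [sub_eq_add_neg] using one_sub_pow_mul_ne_zero hp1 hx k)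
    (summable_norm_pow_mul hp1 x)
  simpa [qProd, sub_eq_add_neg] using this

lemma tendsto_qPochFin {p : ℂ} (hp1 : ‖p‖ < 1) :
    Tendsto (qPochFin p) atTop (𝓝 (qPoch p)) := by
  have h := (multipliable_qProd hp1 p).hasProd.tendsto_prod_nat
  simp only [← pow_succ] at h
  exact h

lemma qPochFin_ne_zero {p : ℂ} (hp1 : ‖p‖ < 1) (n : ℕ) : qPochFin p n ≠ 0 :=
  Finset.prod_ne_zero_iff.2 fun k _ => by
    rw [pow_succ]; exact one_sub_pow_mul_ne_zero hp1 hp1 k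

lemma qPoch_ne_zero {p : ℂ} (hp1 : ‖p‖ < 1) : qPoch p ≠ 0 := by
  rw [qPoch_eq_qProd]; exact qProd_ne_zero hp1 hp1

lemma gaussBinom_eq_div {p : ℂ} (hp1 : ‖p‖ < 1) (k m : ℕ) :
    gaussBinom p (k + m) k = qPochFin p (k + m) * ((qPochFin p k)⁻¹ * (qPochFin p m)⁻¹) := by
  rw [← gaussBinom_mul_qPochFin]
  have := qPochFin_ne_zero hp1 k
  have := qPochFin_ne_zero hp1 m
  field_simp

lemma exists_norm_gaussBinom_le {p : ℂ} (hp1 : ‖p‖ < 1) :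
    ∃ C : ℝ, 0 ≤ C ∧ ∀ n k, ‖gaussBinom p n k‖ ≤ C := by
  obtain ⟨A, hA⟩ := (tendsto_qPochFin hp1).norm.bddAbove_range
  obtain ⟨B, hB⟩ := ((tendsto_qPochFin hp1).inv₀ (qPoch_ne_zero hp1)).norm.bddAbove_range
  have hA' : ∀ n, ‖qPochFin p n‖ ≤ A := fun n => hA ⟨n, rfl⟩
  have hB' : ∀ n, ‖(qPochFin p n)⁻¹‖ ≤ B := fun n => hB ⟨n, rfl⟩
  have hA0 : 0 ≤ A := (norm_nonneg _).trans (hA' 0)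
  have hB0 : 0 ≤ B := (norm_nonneg _).trans (hB' 0)
  refine ⟨A * (B * B), by positivity, fun n k => ?_⟩
  rcases lt_or_ge n k with h | h
  · rw [gaussBinom_eq_zero_of_lt p h, norm_zero]; positivity
  · obtain ⟨m, rfl⟩ := Nat.exists_eq_add_of_le h
    rw [gaussBinom_eq_div hp1, norm_mul, norm_mul]
    exact mul_le_mul (hA' _) (mul_le_mul (hB' _) (hB' _) (norm_nonneg _) hB0)
      (by positivity) hA0

lemma tendsto_gaussBinom {p : ℂ} (hp1 : ‖p‖ < 1) (j : ℤ) :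
    Tendsto (fun m : ℕ => gaussBinom p (2 * m) (m + j).toNat) atTop (𝓝 (qPoch p)⁻¹) := by
  have hP := tendsto_qPochFin hp1
  have hne := qPoch_ne_zero hp1
  have h0 : Tendsto (fun m : ℕ => 2 * m) atTop atTop :=
    tendsto_atTop_mono (fun m => by simp only [id]; omega) tendsto_id
  have h1 : ∀ i : ℤ, Tendsto (fun m : ℕ => (m + i).toNat) atTop atTop := fun i =>
    tendsto_atTop.2 fun b => by
      filter_upwards [eventually_ge_atTop (b + i.natAbs)] with m hm
      omega
  have h := (hP.comp h0).mul
    (((hP.comp (h1 j)).inv₀ hne).mul ((hP.comp (h1 (-j))).inv₀ hne))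
  rw [← mul_assoc, mul_inv_cancel₀ hne, one_mul] at h
  refine h.congr' ?_
  filter_upwards [eventually_ge_atTop j.natAbs] with m hm
  have e : 2 * m = (m + j).toNat + (m + -j).toNat := by omega
  simp only [Function.comp]
  conv_rhs => rw [e, gaussBinom_eq_div hp1, ← e]

/-- The theta series. -/
noncomputable def thetaSeries (p x : ℂ) : ℂ := ∑' j : ℤ, thetaTerm p x j

/-- The coefficient of the finite triple product. -/
noncomputable def thetaCoeff (p : ℂ) (m : ℕ) (j : ℤ) : ℂ :=
  if 0 ≤ m + j then gaussBinom p (2 * m) (m + j).toNat else 0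

lemma prod_theta_eq_tsum {p x : ℂ} (hp : p ≠ 0) (hx : x ≠ 0) (m : ℕ) :
    ∏ k ∈ Finset.range m, ((1 - p ^ k * x) * (1 - p ^ (k + 1) / x)) =
      ∑' j : ℤ, thetaCoeff p m j * thetaTerm p x j := by
  have hinj : Function.Injective fun i : ℕ => -(m : ℤ) + i := fun a b h => by
    simp only at h; omega
  have hsupp : Function.support (fun j : ℤ => thetaCoeff p m j * thetaTerm p x j) ⊆
      Set.range fun i : ℕ => -(m : ℤ) + i := by
    intro j hj
    by_cases h : 0 ≤ m + j
    · exact ⟨(m + j).toNat, by simp only; omega⟩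
    · simp [thetaCoeff, h] at hj
  rw [prod_theta_eq_sum hp hx, ← hinj.tsum_eq hsupp, tsum_eq_sum (s := Finset.range (2 * m + 1))]
  · refine Finset.sum_congr rfl fun i _ => ?_
    simp [thetaCoeff]
  · intro i hi
    simp [thetaCoeff, gaussBinom_eq_zero_of_lt p (show 2 * m < i by simpa using hi)]

/-- The Jacobi triple product. -/
lemma ellTheta_eq_thetaSeries {p x : ℂ} (hp : p ≠ 0) (hp1 : ‖p‖ < 1) (hx : x ≠ 0) :
    ellTheta x p = (qPoch p)⁻¹ * thetaSeries p x := by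
  have hm : Multipliable fun k : ℕ => ((1 - p ^ k * x) * (1 - p ^ (k + 1) / x)) := by
    simpa only [pow_succ, mul_div_assoc] using
      (multipliable_qProd hp1 x).mul (multipliable_qProd hp1 (p / x))
  refine tendsto_nhds_unique hm.hasProd.tendsto_prod_nat ?_
  simp only [prod_theta_eq_tsum hp hx]
  rw [thetaSeries, ← tsum_mul_left]
  obtain ⟨C, hC0, hC⟩ := exists_norm_gaussBinom_le hp1
  refine tendsto_tsum_of_dominated_convergence (bound := fun j => C * ‖thetaTerm p x j‖)
    ((summable_norm_thetaTerm hp hp1 hx).mul_left C) (fun j => ?_) (.of_forall fun m j => ?_)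
  · refine Tendsto.mul_const _ ((tendsto_gaussBinom hp1 j).congr' ?_)
    filter_upwards [eventually_ge_atTop j.natAbs] with m hm
    rw [thetaCoeff, if_pos (by omega)]
  · rw [norm_mul]
    refine mul_le_mul_of_nonneg_right ?_ (norm_nonneg _)
    rw [thetaCoeff]
    split_ifs
    · exact hC _ _
    · simpa using hC0

lemma thetaSeries_eq_shift {p x : ℂ} (hp : p ≠ 0) (hx : x ≠ 0) :
    thetaSeries p x = -x * thetaSeries p (p * x) := by
  rw [thetaSeries, thetaSeries, ← tsum_mul_left, ← (Equiv.addRight (1 : ℤ)).tsum_eq]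
  refine tsum_congr fun j => ?_
  rw [Equiv.coe_addRight, thetaTerm_succ hp hx, thetaTerm, thetaTerm, mul_zpow]
  ring

lemma sq_zpow_triangle (p : ℂ) (j : ℤ) :
    (p ^ 2) ^ (j * (j - 1) / 2) = p ^ (j * (j - 1)) := by
  rw [← zpow_natCast p 2, ← zpow_mul, Nat.cast_ofNat, two_mul_triangle]

lemma thetaTerm_sq_neg (p x : ℂ) (j : ℤ) :
    thetaTerm (p ^ 2) (-x) j = p ^ (j * (j - 1)) * x ^ j := by
  rw [thetaTerm, sq_zpow_triangle, neg_eq_neg_one_mul x, mul_zpow]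
  have : ((-1 : ℂ) ^ j) * (-1) ^ j = 1 := by rw [← mul_zpow]; simp
  linear_combination p ^ (j * (j - 1)) * x ^ j * this

lemma thetaTerm_mul_even {p b z : ℂ} (hp : p ≠ 0) (hb : b ≠ 0) (hz : z ≠ 0) (a c : ℤ) :
    thetaTerm p (b * z) (a + c) * thetaTerm p (b / z) (a - c) =
      thetaTerm (p ^ 2) (-b ^ 2) a * thetaTerm (p ^ 2) (-(p * z ^ 2)) c := by
  have e : (a + c) * (a + c - 1) / 2 + (a - c) * (a - c - 1) / 2 =
      a * (a - 1) + (c * (c - 1) + c) := by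
    have h1 := two_mul_triangle (a + c)
    have h2 := two_mul_triangle (a - c)
    linarith
  have e1 : ((-1 : ℂ) ^ (a + c)) * (-1) ^ (a - c) = 1 := by
    rw [← zpow_add₀ (by norm_num), show a + c + (a - c) = 2 * a by ring, zpow_mul]; simp
  have e2 : (b * z) ^ (a + c) * (b / z) ^ (a - c) = (b ^ 2) ^ a * (z ^ 2) ^ c := by
    rw [← zpow_natCast b, ← zpow_natCast z, ← zpow_mul, ← zpow_mul, mul_zpow, div_zpow,
      zpow_add₀ hb, zpow_sub₀ hb, zpow_add₀ hz, zpow_sub₀ hz, Nat.cast_ofNat,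
      two_mul, two_mul, zpow_add₀ hb, zpow_add₀ hz]
    have := zpow_ne_zero a hb
    have := zpow_ne_zero c hb
    have := zpow_ne_zero a hz
    have := zpow_ne_zero c hz
    field_simp
  have e3 := congrArg (fun n : ℤ => p ^ n) e
  simp only [zpow_add₀ hp] at e3
  rw [thetaTerm_sq_neg, thetaTerm_sq_neg, thetaTerm, thetaTerm, mul_zpow p]
  calc _ = ((-1 : ℂ) ^ (a + c) * (-1) ^ (a - c)) *
        (p ^ ((a + c) * (a + c - 1) / 2) * p ^ ((a - c) * (a - c - 1) / 2)) *
        ((b * z) ^ (a + c) * (b / z) ^ (a - c)) := by ring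
    _ = _ := by rw [e1, e2, e3]; ring

lemma thetaTerm_mul_odd {p b z : ℂ} (hp : p ≠ 0) (hb : b ≠ 0) (hz : z ≠ 0) (a c : ℤ) :
    thetaTerm p (b * z) (a + c + 1) * thetaTerm p (b / z) (a - c) =
      -(b * z) * (thetaTerm (p ^ 2) (-(p * b ^ 2)) a *
        thetaTerm (p ^ 2) (-(p ^ 2 * z ^ 2)) c) := by
  rw [thetaTerm_succ hp (mul_ne_zero hb hz), mul_right_comm, thetaTerm_mul_even hp hb hz]
  have e : (p ^ 2) ^ c = p ^ c * p ^ c := by rw [sq, mul_zpow]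
  simp only [thetaTerm_sq_neg, mul_zpow, zpow_add₀ hp, e]
  ring

lemma summable_thetaSeries_sq {p x : ℂ} (hp : p ≠ 0) (hp1 : ‖p‖ < 1) (hx : x ≠ 0) :
    Summable fun j : ℤ => ‖thetaTerm (p ^ 2) x j‖ :=
  summable_norm_thetaTerm (pow_ne_zero 2 hp)
    (by rw [norm_pow]; exact pow_lt_one₀ (norm_nonneg p) hp1 two_ne_zero) hx

lemma thetaSeries_mul_thetaSeries {p b z : ℂ} (hp : p ≠ 0) (hp1 : ‖p‖ < 1)
    (hb : b ≠ 0) (hz : z ≠ 0) :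
    thetaSeries p (b * z) * thetaSeries p (b / z) =
      thetaSeries (p ^ 2) (-b ^ 2) * thetaSeries (p ^ 2) (-(p * z ^ 2)) -
      b * z * (thetaSeries (p ^ 2) (-(p * b ^ 2)) * thetaSeries (p ^ 2) (-(p ^ 2 * z ^ 2))) := by
  have hs1 := summable_norm_thetaTerm hp hp1 (mul_ne_zero hb hz)
  have hs2 := summable_norm_thetaTerm hp hp1 (div_ne_zero hb hz)
  have hsum := summable_mul_of_summable_norm hs1 hs2
  set f : ℤ × ℤ → ℂ := fun x => thetaTerm p (b * z) x.1 * thetaTerm p (b / z) x.2 with hf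
  let ev : ℤ × ℤ → ℤ × ℤ := fun x => (x.1 + x.2, x.1 - x.2)
  let od : ℤ × ℤ → ℤ × ℤ := fun x => (x.1 + x.2 + 1, x.1 - x.2)
  have hev : Function.Injective ev := fun x y h => by
    simp only [ev, Prod.mk.injEq] at h
    ext <;> omega
  have hod : Function.Injective od := fun x y h => by
    simp only [od, Prod.mk.injEq] at h
    ext <;> omega
  have hcompl : IsCompl (Set.range ev) (Set.range od) := by
    rw [isCompl_iff, Set.disjoint_iff_forall_ne, codisjoint_iff_le_sup]
    constructor
    · rintro _ ⟨x, rfl⟩ _ ⟨y, rfl⟩ h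
      simp only [ev, od, Prod.mk.injEq] at h
      omega
    · rintro ⟨m, n⟩ -
      rcases Int.emod_two_eq_zero_or_one (m + n) with h | h
      · exact Or.inl ⟨((m + n) / 2, (m - n) / 2), by
          simp only [ev, Prod.mk.injEq]; omega⟩
      · exact Or.inr ⟨((m + n - 1) / 2, (m - n - 1) / 2), by
          simp only [od, Prod.mk.injEq]; omega⟩
  have hE : HasSum (f ∘ ((↑) : Set.range ev → ℤ × ℤ)) (∑' x, f (ev x)) :=
    hev.hasSum_range_iff.2 (hsum.comp_injective hev).hasSum
  have hO : HasSum (f ∘ ((↑) : Set.range od → ℤ × ℤ)) (∑' x, f (od x)) :=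
    hod.hasSum_range_iff.2 (hsum.comp_injective hod).hasSum
  rw [thetaSeries, thetaSeries, tsum_mul_tsum_of_summable_norm hs1 hs2,
    (hE.add_isCompl hcompl hO).tsum_eq]
  simp only [hf, ev, od, thetaTerm_mul_even hp hb hz, thetaTerm_mul_odd hp hb hz]
  have hp2 := pow_ne_zero 2 hp
  have hb2 := pow_ne_zero 2 hb
  have hz2 := pow_ne_zero 2 hz
  rw [tsum_mul_left, ← tsum_mul_tsum_of_summable_norm
      (summable_thetaSeries_sq hp hp1 (neg_ne_zero.2 hb2))
      (summable_thetaSeries_sq hp hp1 (neg_ne_zero.2 (mul_ne_zero hp hz2))),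
    ← tsum_mul_tsum_of_summable_norm
      (summable_thetaSeries_sq hp hp1 (neg_ne_zero.2 (mul_ne_zero hp hb2)))
      (summable_thetaSeries_sq hp hp1 (neg_ne_zero.2 (mul_ne_zero hp2 hz2)))]
  simp only [thetaSeries]
  ring

/-- A product of two theta functions is a two-by-two determinant. -/
lemma exists_ellTheta_mul_eq_det {p : ℂ} (hp : p ≠ 0) (hp1 : ‖p‖ < 1) :
    ∃ (K : ℂ) (U V : ℂ → ℂ), ∀ b z : ℂ, b ≠ 0 → z ≠ 0 →
      ellTheta (b * z) p * ellTheta (b / z) p = K * b * (V b * U z - U b * V z) := by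
  refine ⟨(qPoch p)⁻¹ ^ 2, fun x => thetaSeries (p ^ 2) (-(p * x ^ 2)),
    fun x => x * thetaSeries (p ^ 2) (-(p ^ 2 * x ^ 2)), fun b z hb hz => ?_⟩
  have h := thetaSeries_mul_thetaSeries hp hp1 hb hz
  rw [thetaSeries_eq_shift (pow_ne_zero 2 hp) (neg_ne_zero.2 (pow_ne_zero 2 hb)), mul_neg] at h
  rw [ellTheta_eq_thetaSeries hp hp1 (mul_ne_zero hb hz),
    ellTheta_eq_thetaSeries hp hp1 (div_ne_zero hb hz)]
  linear_combination (qPoch p)⁻¹ ^ 2 * h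

/-- The Weierstrass three-term identity. -/
lemma ellTheta_three_term {p : ℂ} (hp : p ≠ 0) (hp1 : ‖p‖ < 1) {a b w z : ℂ}
    (ha : a ≠ 0) (hb : b ≠ 0) (hw : w ≠ 0) (hz : z ≠ 0) :
    w * ((ellTheta (b * w) p * ellTheta (b / w) p) * (ellTheta (a * z) p * ellTheta (a / z) p) -
        (ellTheta (a * w) p * ellTheta (a / w) p) * (ellTheta (b * z) p * ellTheta (b / z) p)) =
      -b * ((ellTheta (a * b) p * ellTheta (a / b) p) *
        (ellTheta (w * z) p * ellTheta (w / z) p)) := by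
  obtain ⟨K, U, V, h⟩ := exists_ellTheta_mul_eq_det hp hp1
  rw [h b w hb hw, h a z ha hz, h a w ha hw, h b z hb hz, h a b ha hb, h w z hw hz]
  ring

lemma hasProdLocallyUniformlyOn_qProd {p : ℂ} (hp1 : ‖p‖ < 1) (r : ℝ) :
    HasProdLocallyUniformlyOn (fun (k : ℕ) x => 1 - p ^ k * x) (qProd p) (Metric.ball 0 r) := by
  have h := Summable.hasProdLocallyUniformlyOn_nat_one_add
    (f := fun (k : ℕ) (x : ℂ) => -(p ^ k * x))
    (K := Metric.ball 0 r) Metric.isOpen_ball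
    ((summable_geometric_of_lt_one (norm_nonneg p) hp1).mul_right r)
    (.of_forall fun k x hx => by
      rw [norm_neg, norm_mul, norm_pow]
      exact mul_le_mul_of_nonneg_left (mem_ball_zero_iff.1 hx).le (by positivity))
    (fun k => by fun_prop)
  simp only [← sub_eq_add_neg] at h
  exact h

lemma differentiable_qProd {p : ℂ} (hp1 : ‖p‖ < 1) : Differentiable ℂ (qProd p) := by
  intro x
  have h : DifferentiableOn ℂ (qProd p) (Metric.ball 0 (‖x‖ + 1)) :=
    (hasProdLocallyUniformlyOn_qProd hp1 _).differentiableOn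
      (.of_forall fun s => by fun_prop) Metric.isOpen_ball
  exact h.differentiableAt (Metric.isOpen_ball.mem_nhds (by simp))

/-- The Lambert series `∑ xᵐ / (1 - pᵐ)` over `m ≥ 1`. -/
noncomputable def lambert (p x : ℂ) : ℂ := ∑' m : ℕ, x ^ (m + 1) / (1 - p ^ (m + 1))

lemma summable_lambert_double {p x : ℂ} (hp1 : ‖p‖ < 1) (hx : ‖x‖ < 1) :
    Summable fun i : ℕ × ℕ => (p ^ i.1 * x) ^ (i.2 + 1) := by
  have h1 := summable_geometric_of_lt_one (norm_nonneg p) hp1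
  have h2 := (summable_geometric_of_lt_one (norm_nonneg x) hx).mul_right ‖x‖
  refine (h1.mul_of_nonneg h2 (fun _ => by positivity) (fun _ => by positivity)).of_norm_bounded
    fun i => ?_
  rw [norm_pow, norm_mul, norm_pow, mul_pow, ← pow_succ]
  exact mul_le_mul_of_nonneg_right
    (pow_le_of_le_one (by positivity) (pow_le_one₀ (norm_nonneg p) hp1.le) (by omega))
    (by positivity)

lemma hasSum_lambert_double {p x : ℂ} (hp1 : ‖p‖ < 1) (hx : ‖x‖ < 1) :
    HasSum (fun m : ℕ => x ^ (m + 1) / (1 - p ^ (m + 1)))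
      (∑' i : ℕ × ℕ, (p ^ i.1 * x) ^ (i.2 + 1)) := by
  refine ((Equiv.prodComm ℕ ℕ).hasSum_iff.2
    (summable_lambert_double hp1 hx).hasSum).prod_fiberwise fun m => ?_
  have hm : ‖p ^ (m + 1)‖ < 1 := by
    rw [norm_pow]; exact pow_lt_one₀ (norm_nonneg p) hp1 (by omega)
  have := (hasSum_geometric_of_norm_lt_one hm).mul_right (x ^ (m + 1))
  rw [inv_mul_eq_div] at this
  refine this.congr_fun fun k => ?_
  change (p ^ k * x) ^ (m + 1) = _
  rw [mul_pow, ← pow_mul, ← pow_mul, mul_comm k]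

lemma hasSum_lambert {p x : ℂ} (hp1 : ‖p‖ < 1) (hx : ‖x‖ < 1) :
    HasSum (fun m : ℕ => x ^ (m + 1) / (1 - p ^ (m + 1))) (lambert p x) :=
  (hasSum_lambert_double hp1 hx).summable.hasSum

lemma hasSum_pow_mul_div {p x : ℂ} (hp1 : ‖p‖ < 1) (hx : ‖x‖ < 1) :
    HasSum (fun k : ℕ => p ^ k * x / (1 - p ^ k * x)) (lambert p x) := by
  rw [lambert, (hasSum_lambert_double hp1 hx).tsum_eq]
  refine (summable_lambert_double hp1 hx).hasSum.prod_fiberwise fun k => ?_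
  have hk : ‖p ^ k * x‖ < 1 := by
    rw [norm_mul, norm_pow]
    exact (mul_le_of_le_one_left (norm_nonneg x)
      (pow_le_one₀ (norm_nonneg p) hp1.le)).trans_lt hx
  have := (hasSum_geometric_of_norm_lt_one hk).mul_right (p ^ k * x)
  rw [inv_mul_eq_div] at this
  simpa only [← pow_succ] using this

lemma mul_deriv_qProd {p x : ℂ} (hp1 : ‖p‖ < 1) (hx : ‖x‖ < 1) :
    x * deriv (qProd p) x = -lambert p x * qProd p x := by
  rcases eq_or_ne x 0 with rfl | hx0
  · simp [lambert]
  have hlog : ∀ k : ℕ, logDeriv (fun x : ℂ => 1 - p ^ k * x) x =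
      -x⁻¹ * (p ^ k * x / (1 - p ^ k * x)) := by
    intro k
    have hd : HasDerivAt (fun x : ℂ => 1 - p ^ k * x) (-(p ^ k * 1)) x :=
      ((hasDerivAt_id x).const_mul (p ^ k)).const_sub 1
    rw [logDeriv_apply, hd.deriv]
    field_simp
  have hs := (hasSum_pow_mul_div hp1 hx).mul_left (-x⁻¹)
  simp only [← hlog] at hs
  have h := logDeriv_tprod_eq_tsum (f := fun (k : ℕ) (x : ℂ) => 1 - p ^ k * x)
    (s := Metric.ball 0 1) Metric.isOpen_ball (by simpa using hx)
    (one_sub_pow_mul_ne_zero hp1 hx) (fun k => by fun_prop) hs.summable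
    ⟨_, hasProdLocallyUniformlyOn_qProd hp1 1⟩ (qProd_ne_zero hp1 hx)
  rw [hs.tsum_eq] at h
  change logDeriv (qProd p) x = _ at h
  rw [logDeriv_apply, div_eq_iff (qProd_ne_zero hp1 hx)] at h
  rw [h]
  field_simp

lemma hasDerivAt_qProd_comp {p : ℂ} (hp1 : ‖p‖ < 1) {g : ℂ → ℂ} {z s : ℂ}
    (hg : HasDerivAt g (s * g z / z) z) (hgz : ‖g z‖ < 1) :
    HasDerivAt (fun w => qProd p (g w)) (-(s * lambert p (g z)) * qProd p (g z) / z) z := by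
  have h := (differentiable_qProd hp1 (g z)).hasDerivAt.comp z hg
  refine h.congr_deriv ?_
  linear_combination s / z * mul_deriv_qProd hp1 hgz

lemma hasDerivAt_ellTheta_mul {p b z : ℂ} (hp1 : ‖p‖ < 1) (hz : z ≠ 0)
    (h1 : ‖b * z‖ < 1) (h2 : ‖p / (b * z)‖ < 1) (h3 : ‖b / z‖ < 1) (h4 : ‖p / (b / z)‖ < 1) :
    HasDerivAt (fun w => ellTheta (b * w) p * ellTheta (b / w) p)
      (ellTheta (b * z) p * ellTheta (b / z) p / z *
        (-lambert p (b * z) + lambert p (p / (b * z)) + lambert p (b / z) -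
          lambert p (p / (b / z)))) z := by
  have hinv : ∀ c : ℂ, HasDerivAt (fun w => c / w) (-1 * (c / z) / z) z := fun c =>
    ((hasDerivAt_inv hz).const_mul c).congr_deriv (by field_simp)
  have hlin : ∀ c : ℂ, HasDerivAt (fun w => c * w) (1 * (c * z) / z) z := fun c =>
    ((hasDerivAt_id z).const_mul c).congr_deriv (by field_simp)
  have e2 : (fun w => p / (b * w)) = fun w => p / b / w := by
    funext w; rw [div_div]
  have e4 : (fun w => p / (b / w)) = fun w => p / b * w := by
    funext w; rw [div_div_eq_mul_div, div_mul_eq_mul_div]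
  have d1 := hasDerivAt_qProd_comp hp1 (hlin b) h1
  have d2 := hasDerivAt_qProd_comp hp1 (g := fun w => p / (b * w)) (s := -1)
    (by simp only [e2, congrFun e2 z]; exact hinv (p / b)) h2
  have d3 := hasDerivAt_qProd_comp hp1 (hinv b) h3
  have d4 := hasDerivAt_qProd_comp hp1 (g := fun w => p / (b / w)) (s := 1)
    (by simp only [e4, congrFun e4 z]; exact hlin (p / b)) h4
  simp only [ellTheta_eq_qProd_mul hp1]
  refine ((d1.mul d2).mul (d3.mul d4)).congr_deriv ?_
  simp only [Pi.mul_apply]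
  ring

lemma ellTheta_ne_zero {p x : ℂ} (hp1 : ‖p‖ < 1) (h1 : ‖x‖ < 1) (h2 : ‖p / x‖ < 1) :
    ellTheta x p ≠ 0 := by
  rw [ellTheta_eq_qProd_mul hp1]
  exact mul_ne_zero (qProd_ne_zero hp1 h1) (qProd_ne_zero hp1 h2)

lemma differentiableAt_ellTheta {p x : ℂ} (hp1 : ‖p‖ < 1) (hx : x ≠ 0) :
    DifferentiableAt ℂ (fun x => ellTheta x p) x := by
  simp only [ellTheta_eq_qProd_mul hp1]
  exact (differentiable_qProd hp1 x).mul ((differentiable_qProd hp1 _).comp x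
    ((differentiableAt_const p).div differentiableAt_id hx))

lemma ellTheta_one {p : ℂ} (hp1 : ‖p‖ < 1) : ellTheta 1 p = 0 := by
  rw [ellTheta_eq_qProd_mul hp1, qProd_eq_one_sub_mul hp1]
  simp

lemma hasDerivAt_ellTheta_one {p : ℂ} (hp1 : ‖p‖ < 1) :
    HasDerivAt (fun x => ellTheta x p) (-qPoch p ^ 2) 1 := by
  have e : (fun x => ellTheta x p) = fun x => (1 - x) * (qProd p (p * x) * qProd p (p / x)) := by
    funext x
    rw [ellTheta_eq_qProd_mul hp1, qProd_eq_one_sub_mul hp1, mul_assoc]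
  have hd : DifferentiableAt ℂ (fun x => qProd p (p * x) * qProd p (p / x)) 1 :=
    ((differentiable_qProd hp1 _).comp (1 : ℂ) (differentiableAt_id.const_mul p)).mul
      ((differentiable_qProd hp1 _).comp (1 : ℂ)
        ((differentiableAt_const p).div differentiableAt_id one_ne_zero))
  rw [e]
  refine (((hasDerivAt_id (1 : ℂ)).const_sub 1).mul hd.hasDerivAt).congr_deriv ?_
  simp [qPoch_eq_qProd, sq]

/-- The infinitesimal form of the Weierstrass three-term identity. -/
lemma lambert_sub_lambert {p a b z : ℂ} (hp : p ≠ 0) (hp1 : ‖p‖ < 1)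
    (ha : a ≠ 0) (hb : b ≠ 0) (hz : z ≠ 0)
    (ha1 : ‖a * z‖ < 1) (ha2 : ‖p / (a * z)‖ < 1) (ha3 : ‖a / z‖ < 1) (ha4 : ‖p / (a / z)‖ < 1)
    (hb1 : ‖b * z‖ < 1) (hb2 : ‖p / (b * z)‖ < 1) (hb3 : ‖b / z‖ < 1) (hb4 : ‖p / (b / z)‖ < 1) :
    (lambert p (a * z) - lambert p (p / (a * z)) - lambert p (a / z) + lambert p (p / (a / z))) -
      (lambert p (b * z) - lambert p (p / (b * z)) - lambert p (b / z) +
        lambert p (p / (b / z))) =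
      qPoch p ^ 2 * b * (ellTheta (a * b) p * ellTheta (a / b) p) * ellTheta (z ^ 2) p /
        (z * (ellTheta (a * z) p * ellTheta (a / z) p * ellTheta (b * z) p *
          ellTheta (b / z) p)) := by
  have da := hasDerivAt_ellTheta_mul hp1 hz ha1 ha2 ha3 ha4
  have db := hasDerivAt_ellTheta_mul hp1 hz hb1 hb2 hb3 hb4
  have hlhs := (hasDerivAt_id z).mul
    ((db.mul_const (ellTheta (a * z) p * ellTheta (a / z) p)).sub
      (da.mul_const (ellTheta (b * z) p * ellTheta (b / z) p)))
  have dq : HasDerivAt (fun w => ellTheta (w / z) p) (-qPoch p ^ 2 * (1 / z)) z := by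
    refine HasDerivAt.comp (h₂ := fun x => ellTheta x p) (h := fun w => w / z) z ?_
      ((hasDerivAt_id z).div_const z)
    rw [div_self hz]
    exact hasDerivAt_ellTheta_one hp1
  have dw : DifferentiableAt ℂ (fun w => ellTheta (w * z) p) z :=
    DifferentiableAt.comp (g := fun x => ellTheta x p) (f := fun w => w * z) z
      (differentiableAt_ellTheta hp1 (mul_ne_zero hz hz)) (differentiableAt_id.mul_const z)
  have hrhs := ((dw.hasDerivAt.mul dq).const_mul
    (ellTheta (a * b) p * ellTheta (a / b) p)).const_mul (-b)
  have heq := hlhs.unique (hrhs.congr_of_eventuallyEq (by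
    filter_upwards [isOpen_ne.mem_nhds hz] with w hw
    exact ellTheta_three_term hp hp1 ha hb hw hz))
  have n1 := ellTheta_ne_zero hp1 ha1 ha2
  have n2 := ellTheta_ne_zero hp1 ha3 ha4
  have n3 := ellTheta_ne_zero hp1 hb1 hb2
  have n4 := ellTheta_ne_zero hp1 hb3 hb4
  simp only [Pi.sub_apply, div_self hz, ellTheta_one hp1, ← sq, id] at heq
  generalize lambert p (a * z) = l1, lambert p (p / (a * z)) = l2, lambert p (a / z) = l3,
    lambert p (p / (a / z)) = l4, lambert p (b * z) = l5, lambert p (p / (b * z)) = l6,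
    lambert p (b / z) = l7, lambert p (p / (b / z)) = l8 at heq ⊢
  generalize ellTheta (a * z) p = t1, ellTheta (a / z) p = t2, ellTheta (b * z) p = t3,
    ellTheta (b / z) p = t4, ellTheta (a * b) p = t5, ellTheta (a / b) p = t6,
    ellTheta (z ^ 2) p = t7 at heq n1 n2 n3 n4 ⊢
  rw [eq_div_iff (by simp [*])]
  field_simp at heq
  linear_combination heq

/-- The Laurent expansion used in the proof of Lemma 3.3. -/
theorem laurent_expansion (p b0 b1 : ℂ)
    (hp0 : 0 < ‖p‖) (hp1 : ‖p‖ < 1)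
    (hb0l : ‖p‖ < ‖b0‖) (hb0u : ‖b0‖ < 1)
    (hb1l : ‖p‖ < ‖b1‖) (hb1u : ‖b1‖ < 1)
    (z : ℂ)
    (hzl : max (max (‖b0‖) (‖b1‖))
        (max (‖p‖ / ‖b0‖) (‖p‖ / ‖b1‖)) <
      ‖z‖)
    (hzu : ‖z‖ <
      (max (max (‖b0‖) (‖b1‖))
        (max (‖p‖ / ‖b0‖) (‖p‖ / ‖b1‖)))⁻¹) :
    HasSum
      (fun k : {k : ℤ // k ≠ 0} =>
        ((b0 ^ (k : ℤ) + (p / b0) ^ (k : ℤ) - b1 ^ (k : ℤ) - (p / b1) ^ (k : ℤ)) /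
            (1 - p ^ (k : ℤ))) * z ^ (k : ℤ))
      (qPoch p ^ 2 * b1 * (ellTheta (b0 * b1) p * ellTheta (b0 / b1) p) *
        ellTheta (z ^ 2) p /
        (z * (ellTheta (b0 * z) p * ellTheta (b0 / z) p *
          ellTheta (b1 * z) p * ellTheta (b1 / z) p))) := by
  have hp : p ≠ 0 := norm_pos_iff.1 hp0
  have h0 : b0 ≠ 0 := norm_pos_iff.1 (hp0.trans hb0l)
  have h1 : b1 ≠ 0 := norm_pos_iff.1 (hp0.trans hb1l)
  set ρ := max (max (‖b0‖) (‖b1‖)) (max (‖p‖ / ‖b0‖) (‖p‖ / ‖b1‖)) with hρ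
  have hb0ρ : ‖b0‖ ≤ ρ := (le_max_left _ _).trans (le_max_left _ _)
  have hb1ρ : ‖b1‖ ≤ ρ := (le_max_right _ _).trans (le_max_left _ _)
  have hpb0ρ : ‖p‖ / ‖b0‖ ≤ ρ := (le_max_left _ _).trans (le_max_right _ _)
  have hpb1ρ : ‖p‖ / ‖b1‖ ≤ ρ := (le_max_right _ _).trans (le_max_right _ _)
  have hρ0 : 0 < ρ := (hp0.trans hb0l).trans_le hb0ρ
  have hz0 : 0 < ‖z‖ := hρ0.trans hzl
  have hz : z ≠ 0 := norm_pos_iff.1 hz0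
  have hρz : ρ * ‖z‖ < 1 := by
    rw [← mul_inv_cancel₀ hρ0.ne']; exact mul_lt_mul_of_pos_left hzu hρ0
  have small : ∀ b : ℂ, ‖b‖ ≤ ρ → ‖p‖ / ‖b‖ ≤ ρ →
      ‖b * z‖ < 1 ∧ ‖p / (b * z)‖ < 1 ∧ ‖b / z‖ < 1 ∧ ‖p / (b / z)‖ < 1 := by
    intro b hb hpb
    rw [← div_div, div_div_eq_mul_div, mul_div_right_comm]
    simp only [norm_mul, norm_div]
    refine ⟨?_, ?_, ?_, ?_⟩
    · exact (mul_le_mul_of_nonneg_right hb hz0.le).trans_lt hρz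
    · exact (div_lt_one hz0).2 (hpb.trans_lt hzl)
    · exact (div_lt_one hz0).2 (hb.trans_lt hzl)
    · exact (mul_le_mul_of_nonneg_right hpb hz0.le).trans_lt hρz
  obtain ⟨a1, a2, a3, a4⟩ := small b0 hb0ρ hpb0ρ
  obtain ⟨c1, c2, c3, c4⟩ := small b1 hb1ρ hpb1ρ
  rw [← lambert_sub_lambert hp hp1 h0 h1 hz a1 a2 a3 a4 c1 c2 c3 c4]
  have L := fun {x : ℂ} (hx : ‖x‖ < 1) => hasSum_lambert hp1 hx
  have hpow : ∀ n : ℕ, 1 - p ^ (n + 1) ≠ 0 := fun n => by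
    rw [pow_succ]; exact one_sub_pow_mul_ne_zero hp1 hp1 n
  set c : ℤ → ℂ := fun k => ((b0 ^ k + (p / b0) ^ k - b1 ^ k - (p / b1) ^ k) /
            (1 - p ^ k)) * z ^ k with hc
  have hpos := (((L a1).add (L a4)).sub (L c1)).sub (L c4)
  have hneg := (((L c2).add (L c3)).sub (L a2)).sub (L a3)
  have key := HasSum.of_add_one_of_neg_add_one (f := c)
    (hpos.congr_fun fun n => by
      have := hpow n
      simp only [hc, ← Nat.cast_succ, zpow_natCast, mul_pow, div_pow]
      field_simp)
    (hneg.congr_fun fun n => by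
      have := hpow n
      have : p ^ (n + 1) - 1 ≠ 0 := by rw [← neg_ne_zero, neg_sub]; exact this
      simp only [hc, ← Nat.cast_succ, zpow_neg, zpow_natCast, mul_pow, div_pow]
      field_simp
      ring)
  have hsupp : Function.support c ⊆ {k : ℤ | k ≠ 0} := by
    rintro k hk rfl
    simp [hc] at hk
  have hc0 : c 0 = 0 := by simp [hc]
  have h := (hasSum_subtype_iff_of_support_subset hsupp).2 key
  rw [hc0] at h
  rw [show (lambert p (b0 * z) - lambert p (p / (b0 * z)) - lambert p (b0 / z) +
      lambert p (p / (b0 / z))) - (lambert p (b1 * z) - lambert p (p / (b1 * z)) -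
      lambert p (b1 / z) + lambert p (p / (b1 / z))) =
    lambert p (b0 * z) + lambert p (p / (b0 / z)) - lambert p (b1 * z) - lambert p (p / (b1 / z)) +
      0 + (lambert p (p / (b1 * z)) + lambert p (b1 / z) - lambert p (p / (b0 * z)) -
      lambert p (b0 / z)) by ring]
  exact h
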